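/- arXiv:1109.1451 — 3 statements merged into one kernel-verified Lean document; each statement's English description precedes it below -/
import Mathlib

section
/- For every partition λ and every integer i ≥ 1, the operations ↑ and ↓ are exchanged by conjugation: (λ^t)↑i = (λ↓i)^t. -/
/-- A partition, recorded by its parts: `f k` is the `(k+1)`-st part `λ_{k+1}`
(0-indexed), so the parts are weakly decreasing and eventually zero. -/
def IsPartition (f : ℕ → ℕ) : Prop :=
  (∀ k, f (k + 1) ≤ f k) ∧ ∃ N, f N = 0

/-- `|λ|`, the size (sum of the parts) of a partition. -/
noncomputable def psize (f : ℕ → ℕ) : ℕ := ∑' k, f k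

/-- `ℓ(λ)`, the number of nonzero parts of a partition. -/
noncomputable def plength (f : ℕ → ℕ) : ℕ := Set.ncard {k | f k ≠ 0}

/-- `u_i(λ)`, the number of parts of `λ` that are `≥ i`. -/
noncomputable def ucount (f : ℕ → ℕ) (i : ℕ) : ℕ := Set.ncard {k | i ≤ f k}

/-- `λ↑i`: the parts `λ_1,…,λ_{u_i(λ)}` each lose one, a new part `i - 1` is inserted
at (1-indexed) position `u_i(λ) + 1`, and the remaining parts are unchanged
(trailing zeros are irrelevant in this representation). -/
noncomputable def upP (f : ℕ → ℕ) (i : ℕ) : ℕ → ℕ := fun k =>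
  if k < ucount f i then f k - 1
  else if k = ucount f i then i - 1
  else f (k - 1)

/-- `λ↓j`: the (1-indexed) part `λ_j` is removed and the parts before it each gain one
(trailing zeros are irrelevant in this representation). -/
def downP (f : ℕ → ℕ) (j : ℕ) : ℕ → ℕ := fun k =>
  if k + 1 < j then f k + 1 else f (k + 1)

/-- The conjugate partition: the (1-indexed) part `(λᵗ)_j` is the number of
parts of `λ` that are `≥ j` (here 0-indexed, so position `k` records `u_{k+1}(λ)`). -/
noncomputable def conjP (f : ℕ → ℕ) : ℕ → ℕ := fun k => ucount f (k + 1)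

theorem IsPartition.antitone {f : ℕ → ℕ} (hf : IsPartition f) : Antitone f :=
  antitone_nat_of_succ_le hf.1

theorem ucount_eq_of_forall {f : ℕ → ℕ} {i n : ℕ} (h : ∀ k, i ≤ f k ↔ k < n) :
    ucount f i = n := by
  have hset : {k | i ≤ f k} = (Finset.range n : Set ℕ) := by
    ext k
    simp [h]
  rw [ucount, hset, Set.ncard_coe_finset, Finset.card_range]

theorem IsPartition.lt_ucount_iff {f : ℕ → ℕ} (hf : IsPartition f) {i : ℕ} (hi : 1 ≤ i)
    (k : ℕ) : k < ucount f i ↔ i ≤ f k := by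
  have hex : ∃ n, f n < i := by
    obtain ⟨N, hN⟩ := hf.2
    exact ⟨N, by omega⟩
  have h : ∀ m, i ≤ f m ↔ m < Nat.find hex := by
    intro m
    rw [Nat.lt_find_iff]
    exact ⟨fun hm j hj => not_lt.2 (hm.trans (hf.antitone hj)), fun hm => not_lt.1 (hm m le_rfl)⟩
  rw [ucount_eq_of_forall h, h]

theorem IsPartition.ucount_conjP {f : ℕ → ℕ} (hf : IsPartition f) {i : ℕ} (hi : 1 ≤ i) :
    ucount (conjP f) i = f (i - 1) := by
  refine ucount_eq_of_forall fun k => ?_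
  have h := hf.lt_ucount_iff (Nat.le_add_left 1 k) (i - 1)
  simp only [conjP]
  omega

/-- For every partition `λ` and every integer `i ≥ 1`, `(λᵗ)↑i = (λ↓i)ᵗ`. -/
theorem conjP_upP_downP (f : ℕ → ℕ) (hf : IsPartition f) (i : ℕ) (hi : 1 ≤ i) :
    upP (conjP f) i = conjP (downP f i) := by
  funext k
  refine (ucount_eq_of_forall fun m => ?_).symm
  simp only [upP, downP, hf.ucount_conjP hi]
  have hge : i ≤ m + 1 → f m ≤ f (i - 1) := fun h => hf.antitone (by omega)
  have hsucc := hf.1 m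
  have hcount := hf.lt_ucount_iff (Nat.le_add_left 1 k) (m + 1)
  have hpred := hf.lt_ucount_iff (Nat.le_add_left 1 (k - 1)) m
  have hle : m + 1 < i → f (i - 1) ≤ f (m + 1) := fun h => hf.antitone (by omega)
  simp only [conjP]
  split_ifs <;> omega
end

section
/- (Theorem 3.1, coefficient form.) Let R be a commutative ring and let g_λ(n) ∈ R be given for every partition λ and every n ∈ ℤ; set a^λ_μ(n) := g_λ(n) if λ = μ and a^λ_μ(n) := 0 otherwise. Then the family a^λ_μ(n) satisfies the 2-Toda coefficient conditions if and only if g satisfies the diagonal 2-Toda coefficient condition. -/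
open Finset in
/-- The 2-Toda coefficient conditions (Theorem 2.2(iii)) for a family of scalars
`A lam mu n` (the coefficient `a^λ_μ(n)`): for all `m, k ∈ ℤ` and all partitions
`α, β, λ, μ`,
`Σ_{i,j} (-1)^{|α|-|α↑j|+i+j} a^{λ↓i}_μ(m) a^{α↑j}_β(k+1)
   = Σ_{s,t} (-1)^{|μ|-|μ↑s|+s+t} a^λ_{μ↑s}(m+1) a^α_{β↓t}(k)`,
where the first (finite) sum is over integers `i, j ≥ 1` with
`|λ↓i| + |α↑j| = |λ| + |α| + m - k` and the second (finite) sum is over integers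
`s, t ≥ 1` with `|μ↑s| + |β↓t| = |μ| + |β| + k - m`. -/
def TwoTodaCoeff {R : Type*} [CommRing R] (A : (ℕ → ℕ) → (ℕ → ℕ) → ℤ → R) : Prop :=
  ∀ m k : ℤ, ∀ al be la mu : ℕ → ℕ,
    IsPartition al → IsPartition be → IsPartition la → IsPartition mu →
    (∑ᶠ ij : ℕ × ℕ,
      if 1 ≤ ij.1 ∧ 1 ≤ ij.2 ∧
          (psize (downP la ij.1) : ℤ) + (psize (upP al ij.2) : ℤ) =
            (psize la : ℤ) + (psize al : ℤ) + m - k then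
        ((Int.negOnePow ((psize al : ℤ) - (psize (upP al ij.2) : ℤ) + ij.1 + ij.2) : ℤ) : R) *
          A (downP la ij.1) mu m * A (upP al ij.2) be (k + 1)
      else 0) =
    (∑ᶠ st : ℕ × ℕ,
      if 1 ≤ st.1 ∧ 1 ≤ st.2 ∧
          (psize (upP mu st.1) : ℤ) + (psize (downP be st.2) : ℤ) =
            (psize mu : ℤ) + (psize be : ℤ) + k - m then
        ((Int.negOnePow ((psize mu : ℤ) - (psize (upP mu st.1) : ℤ) + st.1 + st.2) : ℤ) : R) *
          A la (upP mu st.1) (m + 1) * A al (downP be st.2) k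
      else 0)

/-- The diagonal 2-Toda coefficient condition (Theorem 3.1) for a family of
scalars `g lam n` (the coefficient `g_λ(n)`): for all partitions `λ, μ`, all
`n, m ∈ ℤ` and all integers `i, j ≥ 1` with
`|λ| + |μ| = |λ↑i| + |μ↓j| + n - m - 1`, one has
`g_{λ↑i}(n) g_{μ↓j}(m) = g_λ(n-1) g_μ(m+1)`. -/
def DiagTodaCoeff {R : Type*} [CommRing R] (g : (ℕ → ℕ) → ℤ → R) : Prop :=
  ∀ la mu : ℕ → ℕ, IsPartition la → IsPartition mu → ∀ n m : ℤ, ∀ i j : ℕ,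
    1 ≤ i → 1 ≤ j →
    (psize la : ℤ) + (psize mu : ℤ) =
      (psize (upP la i) : ℤ) + (psize (downP mu j) : ℤ) + n - m - 1 →
    g (upP la i) n * g (downP mu j) m = g la (n - 1) * g mu (m + 1)

namespace IsPartition

variable {f : ℕ → ℕ}

lemma antitone_s15 (hf : IsPartition f) : Antitone f := antitone_nat_of_succ_le hf.1

lemma lt_ucount_iff_s15 (hf : IsPartition f) {i : ℕ} (hi : 1 ≤ i) (k : ℕ) :
    k < ucount f i ↔ i ≤ f k := by
  classical
  have hex : ∃ N, f N < i := by
    obtain ⟨N, hN⟩ := hf.2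
    exact ⟨N, by omega⟩
  have hset : {k | i ≤ f k} = Set.Iio (Nat.find hex) := by
    ext k
    simp only [Set.mem_ofPred_eq, Set.mem_Iio, Nat.lt_find_iff, not_lt]
    exact ⟨fun h m hm => h.trans (hf.antitone_s15 hm), fun h => h k le_rfl⟩
  have hcount : ucount f i = Nat.find hex := by
    rw [ucount, hset, ← Finset.coe_Iio, Set.ncard_coe_finset, Nat.card_Iio]
  rw [hcount, ← Set.mem_Iio, ← hset, Set.mem_ofPred_eq]

lemma ucount_eq (hf : IsPartition f) {i p : ℕ} (hi : 1 ≤ i) (h : ∀ k, k < p ↔ i ≤ f k) :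
    ucount f i = p := by
  have h' : ∀ k, k < ucount f i ↔ k < p := fun k => (hf.lt_ucount_iff_s15 hi k).trans (h k).symm
  have h1 := h' p
  have h2 := h' (ucount f i)
  omega

lemma downP (hf : IsPartition f) (j : ℕ) : IsPartition (downP f j) := by
  refine ⟨fun k => ?_, ?_⟩
  · have h1 := hf.1 k
    have h2 := hf.1 (k + 1)
    simp only [_root_.downP]
    split_ifs <;> omega
  · obtain ⟨N, hN⟩ := hf.2
    refine ⟨N + j, ?_⟩
    have := hf.antitone_s15 (show N ≤ N + j + 1 by omega)
    simp only [_root_.downP]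
    split_ifs <;> omega

lemma upP (hf : IsPartition f) {i : ℕ} (hi : 1 ≤ i) : IsPartition (upP f i) := by
  have hu := hf.lt_ucount_iff_s15 hi
  refine ⟨fun k => ?_, ?_⟩
  · have h1 := hf.1 k
    have h2 := hf.1 (k - 1)
    have h3 := hu k
    have h4 := hu (k - 1)
    have h5 := hu (k + 1)
    rcases k with _ | k
    · simp only [_root_.upP, Nat.add_sub_cancel]
      split_ifs <;> omega
    · simp only [_root_.upP, Nat.add_sub_cancel] at *
      split_ifs <;> omega
  · obtain ⟨N, hN⟩ := hf.2
    refine ⟨N + ucount f i + 1, ?_⟩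
    have := hf.antitone_s15 (show N ≤ N + ucount f i by omega)
    simp only [_root_.upP, Nat.add_sub_cancel]
    split_ifs <;> omega

lemma upP_downP (hf : IsPartition f) {i : ℕ} (hi : 1 ≤ i) :
    _root_.upP (_root_.downP f i) (f (i - 1) + 1) = f := by
  have hu : ucount (_root_.downP f i) (f (i - 1) + 1) = i - 1 := by
    refine (hf.downP i).ucount_eq (by omega) fun k => ?_
    simp only [_root_.downP]
    split_ifs with h
    · have := hf.antitone_s15 (show k ≤ i - 1 by omega)
      omega
    · have := hf.antitone_s15 (show i - 1 ≤ k + 1 by omega)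
      omega
  funext k
  simp only [_root_.upP, _root_.downP, hu]
  rcases lt_trichotomy k (i - 1) with h | rfl | h
  · rw [if_pos h, if_pos (by omega), Nat.add_sub_cancel]
  · simp
  · rw [if_neg (by omega), if_neg (by omega), if_neg (by omega), show k - 1 + 1 = k by omega]

lemma upP_ucount (f : ℕ → ℕ) (i : ℕ) : _root_.upP f i (ucount f i) = i - 1 := by
  simp [_root_.upP]

lemma downP_upP (hf : IsPartition f) {i : ℕ} (hi : 1 ≤ i) :
    _root_.downP (_root_.upP f i) (ucount f i + 1) = f := by
  funext k
  have hu := hf.lt_ucount_iff_s15 hi k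
  simp only [_root_.upP, _root_.downP, Nat.add_sub_cancel]
  split_ifs <;> omega

lemma downP_injective (hf : IsPartition f) {i j : ℕ} (hi : 1 ≤ i) (hj : 1 ≤ j)
    (h : _root_.downP f i = _root_.downP f j) : i = j := by
  have h1 := congrFun h (i - 1)
  have h2 := congrFun h (j - 1)
  have h3 := hf.1 (i - 1)
  have h4 := hf.1 (j - 1)
  simp only [_root_.downP] at h1 h2
  split_ifs at h1 h2 <;> omega

lemma upP_injective (hf : IsPartition f) {i j : ℕ} (hi : 1 ≤ i) (hj : 1 ≤ j)
    (h : _root_.upP f i = _root_.upP f j) : i = j := by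
  have hd : _root_.downP (_root_.upP f i) (ucount f i + 1) =
      _root_.downP (_root_.upP f i) (ucount f j + 1) := by
    rw [hf.downP_upP hi, h, hf.downP_upP hj]
  have hu := (hf.upP hi).downP_injective (by omega) (by omega) hd
  have h1 := upP_ucount f i
  have h2 := upP_ucount f j
  rw [← h, ← Nat.succ_injective hu, h1] at h2
  omega

lemma psize_eq_sum_range (hf : IsPartition f) {n : ℕ} (hn : f n = 0) :
    psize f = ∑ k ∈ Finset.range n, f k := by
  refine tsum_eq_sum fun k hk => ?_
  have := hf.antitone_s15 (not_lt.mp (mt Finset.mem_range.mpr hk))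
  omega

lemma psize_downP (hf : IsPartition f) {i : ℕ} (hi : 1 ≤ i) :
    psize (_root_.downP f i) + f (i - 1) = psize f + (i - 1) := by
  obtain ⟨p, rfl⟩ : ∃ p, i = p + 1 := ⟨i - 1, by omega⟩
  have key : ∀ d, ∑ k ∈ Finset.range (p + d), _root_.downP f (p + 1) k + f p =
      ∑ k ∈ Finset.range (p + d + 1), f k + p := by
    intro d
    induction d with
    | zero =>
      have h : ∀ k ∈ Finset.range p, _root_.downP f (p + 1) k = f k + 1 := fun k hk => by
        have := Finset.mem_range.mp hk
        rw [_root_.downP, if_pos (by omega)]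
      rw [Nat.add_zero, Finset.sum_congr rfl h, Finset.sum_add_distrib, Finset.sum_range_succ]
      simp only [Finset.sum_const, Finset.card_range, smul_eq_mul, mul_one]
      omega
    | succ d ih =>
      rw [← add_assoc, Finset.sum_range_succ, Finset.sum_range_succ f, _root_.downP,
        if_neg (by omega)]
      omega
  obtain ⟨N, hN⟩ := hf.2
  have h0 : f (p + N + 1) = 0 := by
    have := hf.antitone_s15 (show N ≤ p + N + 1 by omega)
    omega
  have h1 : _root_.downP f (p + 1) (p + N) = 0 := by
    rw [_root_.downP, if_neg (by omega), h0]
  rw [hf.psize_eq_sum_range h0, (hf.downP _).psize_eq_sum_range h1]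
  exact key N

lemma psize_upP (hf : IsPartition f) {i : ℕ} (hi : 1 ≤ i) :
    psize (_root_.upP f i) + ucount f i = psize f + (i - 1) := by
  have h := (hf.upP hi).psize_downP (show 1 ≤ ucount f i + 1 by omega)
  rw [hf.downP_upP hi, Nat.add_sub_cancel, upP_ucount] at h
  exact h.symm

end IsPartition

/-- The sign attached to the moves `la↓i`, `al↑j` equals the sign attached to their inverses. -/
lemma negOnePow_downP_upP {la al : ℕ → ℕ} (hla : IsPartition la) (hal : IsPartition al)
    {i j : ℕ} (hi : 1 ≤ i) (hj : 1 ≤ j) :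
    Int.negOnePow ((psize (downP la i) : ℤ) - psize la + (la (i - 1) + 1 : ℕ) +
        (ucount al j + 1 : ℕ)) =
      Int.negOnePow ((psize al : ℤ) - psize (upP al j) + i + j) := by
  have h1 := hla.psize_downP hi
  have h2 := hal.psize_upP hj
  congr 1
  omega

section Diagonal

variable {R : Type*} [CommRing R] (g : (ℕ → ℕ) → ℤ → R)

open Classical in
lemma finsum_diagonal_left {la al : ℕ → ℕ} (hla : IsPartition la) (hal : IsPartition al)
    {i j : ℕ} (hi : 1 ≤ i) (hj : 1 ≤ j) (m k c : ℤ) :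
    (∑ᶠ ij : ℕ × ℕ,
      if 1 ≤ ij.1 ∧ 1 ≤ ij.2 ∧
          (psize (downP la ij.1) : ℤ) + (psize (upP al ij.2) : ℤ) = c then
        ((Int.negOnePow ((psize al : ℤ) - (psize (upP al ij.2) : ℤ) + ij.1 + ij.2) : ℤ) : R) *
          (if downP la ij.1 = downP la i then g (downP la ij.1) m else 0) *
          (if upP al ij.2 = upP al j then g (upP al ij.2) k else 0)
      else 0) =
    if (psize (downP la i) : ℤ) + (psize (upP al j) : ℤ) = c then
      ((Int.negOnePow ((psize al : ℤ) - (psize (upP al j) : ℤ) + i + j) : ℤ) : R) *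
        g (downP la i) m * g (upP al j) k
    else 0 := by
  rw [finsum_eq_single _ (i, j)]
  · simp [hi, hj]
  · rintro ⟨i', j'⟩ hne
    by_cases h : 1 ≤ i' ∧ 1 ≤ j'
    · by_cases h1 : downP la i' = downP la i
      · have h2 : upP al j' ≠ upP al j := fun h2 => hne <| by
          rw [hla.downP_injective h.1 hi h1, hal.upP_injective h.2 hj h2]
        simp [h2]
      · simp [h1]
    · exact if_neg fun h' => h ⟨h'.1, h'.2.1⟩

open Classical in
lemma finsum_diagonal_right {mu be : ℕ → ℕ} (hmu : IsPartition mu) (hbe : IsPartition be)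
    {s t : ℕ} (hs : 1 ≤ s) (ht : 1 ≤ t) (m k c : ℤ) :
    (∑ᶠ st : ℕ × ℕ,
      if 1 ≤ st.1 ∧ 1 ≤ st.2 ∧
          (psize (upP mu st.1) : ℤ) + (psize (downP be st.2) : ℤ) = c then
        ((Int.negOnePow ((psize mu : ℤ) - (psize (upP mu st.1) : ℤ) + st.1 + st.2) : ℤ) : R) *
          (if upP mu s = upP mu st.1 then g (upP mu s) m else 0) *
          (if downP be t = downP be st.2 then g (downP be t) k else 0)
      else 0) =
    if (psize (upP mu s) : ℤ) + (psize (downP be t) : ℤ) = c then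
      ((Int.negOnePow ((psize mu : ℤ) - (psize (upP mu s) : ℤ) + s + t) : ℤ) : R) *
        g (upP mu s) m * g (downP be t) k
    else 0 := by
  rw [finsum_eq_single _ (s, t)]
  · simp [hs, ht]
  · rintro ⟨s', t'⟩ hne
    by_cases h : 1 ≤ s' ∧ 1 ≤ t'
    · by_cases h1 : upP mu s = upP mu s'
      · have h2 : downP be t ≠ downP be t' := fun h2 => hne <| by
          rw [hmu.upP_injective hs h.1 h1, hbe.downP_injective ht h.2 h2]
        simp [h2]
      · simp [h1]
    · exact if_neg fun h' => h ⟨h'.1, h'.2.1⟩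

open Classical in
/-- The instance of the 2-Toda coefficient conditions for a diagonal family at `mu = la↓i`,
`be = al↑j` amounts to a single instance of the diagonal condition. -/
lemma diagonal_coeff_iff {la al : ℕ → ℕ} (hla : IsPartition la) (hal : IsPartition al)
    {i j : ℕ} (hi : 1 ≤ i) (hj : 1 ≤ j) (m k : ℤ) :
    ((∑ᶠ ij : ℕ × ℕ,
      if 1 ≤ ij.1 ∧ 1 ≤ ij.2 ∧
          (psize (downP la ij.1) : ℤ) + (psize (upP al ij.2) : ℤ) =
            (psize la : ℤ) + (psize al : ℤ) + m - k then
        ((Int.negOnePow ((psize al : ℤ) - (psize (upP al ij.2) : ℤ) + ij.1 + ij.2) : ℤ) : R) *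
          (if downP la ij.1 = downP la i then g (downP la ij.1) m else 0) *
          (if upP al ij.2 = upP al j then g (upP al ij.2) (k + 1) else 0)
      else 0) =
    (∑ᶠ st : ℕ × ℕ,
      if 1 ≤ st.1 ∧ 1 ≤ st.2 ∧
          (psize (upP (downP la i) st.1) : ℤ) + (psize (downP (upP al j) st.2) : ℤ) =
            (psize (downP la i) : ℤ) + (psize (upP al j) : ℤ) + k - m then
        ((Int.negOnePow ((psize (downP la i) : ℤ) - (psize (upP (downP la i) st.1) : ℤ) +
            st.1 + st.2) : ℤ) : R) *
          (if la = upP (downP la i) st.1 then g la (m + 1) else 0) *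
          (if al = downP (upP al j) st.2 then g al k else 0)
      else 0)) ↔
    ((psize al : ℤ) + (psize la : ℤ) =
        (psize (upP al j) : ℤ) + (psize (downP la i) : ℤ) + (k + 1) - m - 1 →
      g (upP al j) (k + 1) * g (downP la i) m = g al k * g la (m + 1)) := by
  have hright := finsum_diagonal_right g (hla.downP i) (hal.upP hj)
    (show 1 ≤ la (i - 1) + 1 by omega) (show 1 ≤ ucount al j + 1 by omega) (m + 1) k
    ((psize (downP la i) : ℤ) + (psize (upP al j) : ℤ) + k - m)
  rw [hla.upP_downP hi, hal.downP_upP hj, negOnePow_downP_upP hla hal hi hj] at hright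
  rw [finsum_diagonal_left g hla hal hi hj, hright]
  by_cases hc : (psize al : ℤ) + (psize la : ℤ) =
      (psize (upP al j) : ℤ) + (psize (downP la i) : ℤ) + (k + 1) - m - 1
  · rw [if_pos (by omega), if_pos (by omega)]
    set e := Int.negOnePow ((psize al : ℤ) - (psize (upP al j) : ℤ) + i + j)
    have he : IsUnit ((e : ℤ) : R) := e.isUnit.map (Int.castRingHom R)
    rw [mul_assoc, mul_assoc, he.mul_right_inj, mul_comm (g (downP la i) m),
      mul_comm (g la (m + 1))]
    exact ⟨fun h _ => h, fun h => h hc⟩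
  · rw [if_neg (by omega), if_neg (by omega)]
    exact ⟨fun _ h => absurd h hc, fun _ => rfl⟩

end Diagonal

open Classical in
/-- Theorem 3.1 (coefficient form): the diagonal family `a^λ_μ(n) = g_λ(n)` if
`λ = μ` and `0` otherwise satisfies the 2-Toda coefficient conditions if and
only if `g` satisfies the diagonal 2-Toda coefficient condition. -/
theorem twoToda_diagonal_iff {R : Type*} [CommRing R] (g : (ℕ → ℕ) → ℤ → R) :
    TwoTodaCoeff (fun la mu n => if la = mu then g la n else 0) ↔ DiagTodaCoeff g := by
  constructor
  · intro H al la hal hla n m j i hj hi hsize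
    have h := (diagonal_coeff_iff g hla hal hi hj m (n - 1)).mp
      (H m (n - 1) al (upP al j) la (downP la i) hal (hal.upP hj) hla (hla.downP i))
    rw [sub_add_cancel] at h
    exact h hsize
  · intro H m k al be la mu hal hbe hla hmu
    by_cases hex : (∃ i, 1 ≤ i ∧ downP la i = mu) ∧ ∃ j, 1 ≤ j ∧ upP al j = be
    · obtain ⟨⟨i, hi, rfl⟩, j, hj, rfl⟩ := hex
      refine (diagonal_coeff_iff g hla hal hi hj m k).mpr fun hsize => ?_
      have h := H al la hal hla (k + 1) m j i hj hi hsize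
      rwa [add_sub_cancel_right] at h
    · have hleft : ∀ i j, 1 ≤ i → 1 ≤ j → downP la i = mu → upP al j ≠ be :=
        fun i j hi hj h1 h2 => hex ⟨⟨i, hi, h1⟩, j, hj, h2⟩
      have hright : ∀ s t, 1 ≤ s → 1 ≤ t → la = upP mu s → al ≠ downP be t := by
        rintro s t hs ht rfl rfl
        exact hex ⟨⟨_, by omega, hmu.downP_upP hs⟩, _, by omega, hbe.upP_downP ht⟩
      trans (0 : R)
      · refine finsum_eq_zero_of_forall_eq_zero fun ij => ite_eq_right_iff.mpr fun h => ?_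
        by_cases h1 : downP la ij.1 = mu
        · simp [hleft _ _ h.1 h.2.1 h1]
        · simp [h1]
      · refine (finsum_eq_zero_of_forall_eq_zero fun st => ite_eq_right_iff.mpr fun h => ?_).symm
        by_cases h1 : la = upP mu st.1
        · simp [hright _ _ h.1 h.2.1 h1]
        · simp [h1]
end

section
/- (Combinatorial core of the Schur-measure correlator proposition.) Let X ⊆ ℤ, let λ, μ be partitions, let n, m ∈ ℤ and let i, j ≥ 1 be integers with |λ| + |μ| = |λ↑i| + |μ↓j| + n − m − 1. If X − n + 1 ⊆ 𝔖(λ) and X − m − 1 ⊆ 𝔖(μ), then X − n ⊆ 𝔖(λ↑i) and X − m ⊆ 𝔖(μ↓j). -/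
/-- `𝔖(λ) = {λ_i - i : i ≥ 1} ⊆ ℤ` (0-indexed: `λ_{k+1} - (k+1)` for `k ≥ 0`). -/
def shiftedSet (f : ℕ → ℕ) : Set ℤ := {z | ∃ k : ℕ, z = (f k : ℤ) - ((k : ℤ) + 1)}

theorem psize_eq_sum_range {f : ℕ → ℕ} {N : ℕ} (h : ∀ k, N ≤ k → f k = 0) :
    psize f = ∑ k ∈ Finset.range N, f k :=
  tsum_eq_sum fun k hk => h k (by simpa using hk)

theorem IsPartition.exists_forall_ge_eq_zero {f : ℕ → ℕ} (hf : IsPartition f) :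
    ∃ N, ∀ k, N ≤ k → f k = 0 := by
  obtain ⟨N, hN⟩ := hf.2
  exact ⟨N, fun k hk => Nat.le_zero.mp (hN ▸ hf.antitone hk)⟩

theorem IsPartition.le_apply_iff_lt_ucount {f : ℕ → ℕ} (hf : IsPartition f) {i : ℕ}
    (hi : 1 ≤ i) (k : ℕ) : i ≤ f k ↔ k < ucount f i := by
  have hex : ∃ N, f N < i := by
    obtain ⟨N, hN⟩ := hf.2
    exact ⟨N, by omega⟩
  have key : ∀ k, i ≤ f k ↔ k < Nat.find hex := fun k => by
    rw [Nat.lt_find_iff]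
    refine ⟨fun h l hl => ?_, fun h => not_lt.mp (h k le_rfl)⟩
    exact not_lt.mpr (h.trans (hf.antitone hl))
  have hu : ucount f i = Nat.find hex := by
    have hset : {k | i ≤ f k} = ↑(Finset.range (Nat.find hex)) := by
      ext k
      simp only [Set.mem_ofPred_eq, Finset.coe_range, Set.mem_Iio]
      exact key k
    rw [ucount, hset, Set.ncard_coe_finset, Finset.card_range]
  rw [hu]
  exact key k

theorem psize_upP_add_ucount {f : ℕ → ℕ} (hf : IsPartition f) {i : ℕ} (hi : 1 ≤ i) :
    psize (upP f i) + ucount f i = psize f + (i - 1) := by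
  have hu := hf.le_apply_iff_lt_ucount hi
  have initial : ∀ M, M ≤ ucount f i →
      ∑ k ∈ Finset.range M, upP f i k + M = ∑ k ∈ Finset.range M, f k := by
    intro M
    induction M with
    | zero => simp
    | succ M ih =>
      intro hM
      have h₁ := ih (by omega)
      have h₂ := (hu M).mpr hM
      have h₃ : upP f i M = f M - 1 := if_pos hM
      rw [Finset.sum_range_succ, Finset.sum_range_succ]
      omega
  have partial_sum : ∀ M, ucount f i ≤ M →
      ∑ k ∈ Finset.range (M + 1), upP f i k + ucount f i =
        ∑ k ∈ Finset.range M, f k + (i - 1) := by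
    intro M hM
    induction M, hM using Nat.le_induction with
    | base =>
      have h₁ := initial _ le_rfl
      have h₂ : upP f i (ucount f i) = i - 1 := by simp [upP]
      rw [Finset.sum_range_succ]
      omega
    | succ M hM ih =>
      have h₁ : upP f i (M + 1) = f M := by
        rw [upP, if_neg (by omega), if_neg (by omega), Nat.add_sub_cancel]
      rw [Finset.sum_range_succ, Finset.sum_range_succ (fun k => f k)]
      omega
  obtain ⟨N, hN⟩ := hf.exists_forall_ge_eq_zero
  have huN : ucount f i ≤ N := by
    by_contra! h
    have h₁ := (hu N).mpr h
    have h₂ := hN N le_rfl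
    omega
  rw [psize_eq_sum_range hN, psize_eq_sum_range (N := N + 1), partial_sum N huN]
  intro k hk
  rw [upP, if_neg (by omega), if_neg (by omega)]
  exact hN _ (by omega)

theorem psize_downP_add {g : ℕ → ℕ} (hg : IsPartition g) (j : ℕ) :
    psize (downP g (j + 1)) + g j = psize g + j := by
  have initial : ∀ M, M ≤ j →
      ∑ k ∈ Finset.range M, downP g (j + 1) k = ∑ k ∈ Finset.range M, g k + M := by
    intro M
    induction M with
    | zero => simp
    | succ M ih =>
      intro hM
      have h₁ := ih (by omega)
      have h₂ : downP g (j + 1) M = g M + 1 := if_pos (by omega)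
      rw [Finset.sum_range_succ, Finset.sum_range_succ]
      omega
  have partial_sum : ∀ M, j ≤ M →
      ∑ k ∈ Finset.range M, downP g (j + 1) k + g j =
        ∑ k ∈ Finset.range (M + 1), g k + j := by
    intro M hM
    induction M, hM using Nat.le_induction with
    | base =>
      have h₁ := initial _ le_rfl
      rw [Finset.sum_range_succ]
      omega
    | succ M hM ih =>
      have h₁ : downP g (j + 1) M = g (M + 1) := if_neg (by omega)
      rw [Finset.sum_range_succ, Finset.sum_range_succ (fun k => g k)]
      omega
  obtain ⟨N, hN⟩ := hg.exists_forall_ge_eq_zero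
  rw [psize_eq_sum_range (f := g) (N := max N j + 1) fun k hk => hN k (by omega),
    psize_eq_sum_range (N := max N j), partial_sum _ (le_max_right _ _)]
  intro k hk
  rw [downP, if_neg (by omega)]
  exact hN _ (by omega)

theorem sub_one_mem_shiftedSet_upP {f : ℕ → ℕ} (hf : IsPartition f) {i : ℕ} (hi : 1 ≤ i)
    {z : ℤ} (hz : z ∈ shiftedSet f) : z - 1 ∈ shiftedSet (upP f i) := by
  obtain ⟨k, rfl⟩ := hz
  have hu := hf.le_apply_iff_lt_ucount hi k
  by_cases hk : k < ucount f i
  · refine ⟨k, ?_⟩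
    have h₁ := hu.mpr hk
    rw [upP, if_pos hk]
    omega
  · refine ⟨k + 1, ?_⟩
    rw [upP, if_neg (by omega), if_neg (by omega), Nat.add_sub_cancel]
    omega

theorem add_one_mem_shiftedSet_downP {g : ℕ → ℕ} (j : ℕ) {z : ℤ} (hz : z ∈ shiftedSet g)
    (hne : z ≠ (g j : ℤ) - (j + 1)) : z + 1 ∈ shiftedSet (downP g (j + 1)) := by
  obtain ⟨k, rfl⟩ := hz
  rcases lt_trichotomy k j with hk | rfl | hk
  · refine ⟨k, ?_⟩
    rw [downP, if_pos (by omega)]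
    omega
  · exact absurd rfl hne
  · obtain ⟨k, rfl⟩ := Nat.exists_eq_succ_of_ne_zero (by omega : k ≠ 0)
    refine ⟨k, ?_⟩
    rw [downP, if_neg (by omega)]
    simp only [Nat.succ_eq_add_one]
    omega

theorem sub_ucount_sub_one_notMem_shiftedSet {f : ℕ → ℕ} (hf : IsPartition f) {i : ℕ}
    (hi : 1 ≤ i) : (i : ℤ) - ucount f i - 1 ∉ shiftedSet f := by
  rintro ⟨k, hk⟩
  have hu := hf.le_apply_iff_lt_ucount hi k
  omega

/-- Combinatorial core of the Schur-measure correlator proposition: if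
`|λ| + |μ| = |λ↑i| + |μ↓j| + n - m - 1` (with `i, j ≥ 1`), and
`X - n + 1 ⊆ 𝔖(λ)` and `X - m - 1 ⊆ 𝔖(μ)`, then `X - n ⊆ 𝔖(λ↑i)` and
`X - m ⊆ 𝔖(μ↓j)`. -/
theorem schur_correlator_core (X : Set ℤ) (f g : ℕ → ℕ)
    (hf : IsPartition f) (hg : IsPartition g) (n m : ℤ) (i j : ℕ)
    (hi : 1 ≤ i) (hj : 1 ≤ j)
    (hsize : (psize f : ℤ) + (psize g : ℤ) =
      (psize (upP f i) : ℤ) + (psize (downP g j) : ℤ) + n - m - 1)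
    (hX1 : (fun x => x - n + 1) '' X ⊆ shiftedSet f)
    (hX2 : (fun x => x - m - 1) '' X ⊆ shiftedSet g) :
    (fun x => x - n) '' X ⊆ shiftedSet (upP f i) ∧
    (fun x => x - m) '' X ⊆ shiftedSet (downP g j) := by
  obtain ⟨j, rfl⟩ := Nat.exists_eq_add_of_le' hj
  constructor
  · rintro _ ⟨x, hx, rfl⟩
    have h := sub_one_mem_shiftedSet_upP hf hi (hX1 ⟨x, hx, rfl⟩)
    simpa using h
  · rintro _ ⟨x, hx, rfl⟩
    have hne : x - m - 1 ≠ (g j : ℤ) - (j + 1) := by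
      intro h
      refine sub_ucount_sub_one_notMem_shiftedSet hf hi ?_
      have h₁ := psize_upP_add_ucount hf hi
      have h₂ := psize_downP_add hg j
      have h₃ : (i : ℤ) - ucount f i - 1 = x - n + 1 := by omega
      rw [h₃]
      exact hX1 ⟨x, hx, rfl⟩
    have h := add_one_mem_shiftedSet_downP j (hX2 ⟨x, hx, rfl⟩) hne
    simpa using h
end
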